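/- arXiv:1810.07909 — 2 statements merged into one kernel-verified Lean document; each statement's English description precedes it below -/
import Mathlib

section
/- Let e₁, e₂ ∈ C²(ℝ), fix t ∈ (0,T), and let φ ∈ C¹(ℝ³; ℝ³) be such that there is a compact set K ⊂ U with φ(x̂(X,t)) = 0 for all X ∈ U \ K. For ε ∈ (−1,1) set E_D[v + εφ](t) = −∫_{Γ(t)} ½ { e₁(|D_Γ(v + εφ)|²) + e₂(|div_Γ(v + εφ)|²) } dH². Then ε ↦ E_D[v + εφ](t) is differentiable at ε = 0 and (d/dε)|_{ε=0} E_D[v + εφ](t) = ∫_{Γ(t)} div_Γ{ e₁'(|D_Γ(v)|²) D_Γ(v) + e₂'(|div_Γ v|²)(div_Γ v) P_Γ } · φ dH². -/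
noncomputable section
open MeasureTheory

/-- ℝ² with the Euclidean structure. -/
abbrev E2 : Type := EuclideanSpace ℝ (Fin 2)
/-- ℝ³ with the Euclidean structure. -/
abbrev E3 : Type := EuclideanSpace ℝ (Fin 3)

/-- The cross product on ℝ³. -/
def cross3 (a b : E3) : E3 :=
  (EuclideanSpace.equiv (Fin 3) ℝ).symm
    ![a 1 * b 2 - a 2 * b 1, a 2 * b 0 - a 0 * b 2, a 0 * b 1 - a 1 * b 0]

/-- The dot product on ℝ³. -/
def dot3 (a b : E3) : ℝ := ∑ i, a i * b i

/-- The tangent vector `g_α = ∂x̂/∂X_α` of the parametrization `x̂` at `(X, t)`. -/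
def gVec (xh : E2 × ℝ → E3) (α : Fin 2) (X : E2) (t : ℝ) : E3 :=
  fderiv ℝ (fun Y : E2 => xh (Y, t)) X (EuclideanSpace.single α 1)

/-- The Riemannian metric `g_{αβ} = g_α · g_β`. -/
def gMet (xh : E2 × ℝ → E3) (α β : Fin 2) (X : E2) (t : ℝ) : ℝ :=
  dot3 (gVec xh α X t) (gVec xh β X t)

/-- The Gram determinant `G = g₁₁ g₂₂ − g₁₂ g₂₁`. -/
def Gdet (xh : E2 × ℝ → E3) (X : E2) (t : ℝ) : ℝ :=
  gMet xh 0 0 X t * gMet xh 1 1 X t - gMet xh 0 1 X t * gMet xh 1 0 X t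

/-- The inverse metric `(g^{αβ}) = (g_{αβ})⁻¹`. -/
def gInv (xh : E2 × ℝ → E3) (X : E2) (t : ℝ) : Matrix (Fin 2) (Fin 2) ℝ :=
  (Matrix.of fun α β => gMet xh α β X t)⁻¹

/-- The raised tangent vector `g^α = Σ_β g^{αβ} g_β`. -/
def gVecUp (xh : E2 × ℝ → E3) (α : Fin 2) (X : E2) (t : ℝ) : E3 :=
  ∑ β, gInv xh X t α β • gVec xh β X t

/-- The unit normal `n̂ = (g₁ × g₂)/|g₁ × g₂|` of the parametrized surface. -/
def nHat (xh : E2 × ℝ → E3) (X : E2) (t : ℝ) : E3 :=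
  ‖cross3 (gVec xh 0 X t) (gVec xh 1 X t)‖⁻¹ • cross3 (gVec xh 0 X t) (gVec xh 1 X t)

/-- Spatial partial derivative `∂f/∂x_j` at `(x, t)`. -/
def pdx (j : Fin 3) (f : E3 × ℝ → ℝ) (x : E3) (t : ℝ) : ℝ :=
  fderiv ℝ (fun y : E3 => f (y, t)) x (EuclideanSpace.single j 1)

/-- Time partial derivative `∂f/∂t` at `(x, t)`. -/
def pdt (f : E3 × ℝ → ℝ) (x : E3) (t : ℝ) : ℝ := deriv (fun s => f (x, s)) t

/-- Tangential derivative `∂_j^Γ f = Σ_i (δ_{ij} − N_i N_j) ∂f/∂x_i`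
with normal extension `N`. -/
def tder (N : E3 × ℝ → E3) (j : Fin 3) (f : E3 × ℝ → ℝ) (x : E3) (t : ℝ) : ℝ :=
  ∑ i, ((if i = j then (1 : ℝ) else 0) - N (x, t) i * N (x, t) j) * pdx i f x t

/-- Surface gradient `grad_Γ f = (∂_1^Γ f, ∂_2^Γ f, ∂_3^Γ f)`. -/
def sgrad (N : E3 × ℝ → E3) (f : E3 × ℝ → ℝ) (x : E3) (t : ℝ) : E3 :=
  (EuclideanSpace.equiv (Fin 3) ℝ).symm fun j => tder N j f x t

/-- Surface divergence `div_Γ φ = Σ_j ∂_j^Γ φ_j`. -/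
def sdiv (N : E3 × ℝ → E3) (φ : E3 × ℝ → E3) (x : E3) (t : ℝ) : ℝ :=
  ∑ j, tder N j (fun p => φ p j) x t

/-- Row-wise surface divergence of a matrix field: `(div_Γ M)_i = Σ_j ∂_j^Γ M_{ij}`. -/
def sdivM (N : E3 × ℝ → E3) (M : E3 × ℝ → Matrix (Fin 3) (Fin 3) ℝ) (x : E3) (t : ℝ) : E3 :=
  (EuclideanSpace.equiv (Fin 3) ℝ).symm fun i => ∑ j, tder N j (fun p => M p i j) x t

/-- The orthogonal projection matrix `P_Γ = I − N ⊗ N`. -/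
def Pmat (N : E3 × ℝ → E3) (x : E3) (t : ℝ) : Matrix (Fin 3) (Fin 3) ℝ :=
  Matrix.of fun i j => (if i = j then (1 : ℝ) else 0) - N (x, t) i * N (x, t) j

/-- The symmetric gradient `D(φ) = ((∇φ) + (∇φ)ᵀ)/2`. -/
def Dmat (φ : E3 × ℝ → E3) (x : E3) (t : ℝ) : Matrix (Fin 3) (Fin 3) ℝ :=
  Matrix.of fun i j => (pdx i (fun p => φ p j) x t + pdx j (fun p => φ p i) x t) / 2

/-- The surface stretching tensor `D_Γ(φ) = P_Γ D(φ) P_Γ`. -/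
def DGam (N : E3 × ℝ → E3) (φ : E3 × ℝ → E3) (x : E3) (t : ℝ) : Matrix (Fin 3) (Fin 3) ℝ :=
  Pmat N x t * Dmat φ x t * Pmat N x t

/-- The squared Frobenius norm `|M|² = Σ_{i,j} M_{ij}²`. -/
def frob2 (M : Matrix (Fin 3) (Fin 3) ℝ) : ℝ := ∑ i, ∑ j, (M i j) ^ 2

/-- The material derivative `D_t f = ∂_t f + (v · ∇)f`. -/
def Dt (v : E3 × ℝ → E3) (f : E3 × ℝ → ℝ) (x : E3) (t : ℝ) : ℝ :=
  pdt f x t + ∑ i, v (x, t) i * pdx i f x t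

/-- Matrix-vector product on ℝ³. -/
def mulVec3 (M : Matrix (Fin 3) (Fin 3) ℝ) (w : E3) : E3 :=
  (EuclideanSpace.equiv (Fin 3) ℝ).symm (M.mulVec fun i => w i)

section AreaFormula

open Set Filter Module Topology
open scoped NNReal ENNReal

theorem hausdorffMeasure_image_le_of_edist_le {X Y Z : Type*} [EMetricSpace X] [MeasurableSpace X]
    [BorelSpace X] [EMetricSpace Y] [MeasurableSpace Y] [BorelSpace Y] {f : Z → X} {g : Z → Y}
    {A : Set Z} {K : ℝ≥0} {d : ℝ} (hd : 0 ≤ d)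
    (h : ∀ u ∈ A, ∀ w ∈ A, edist (f u) (f w) ≤ K * edist (g u) (g w)) :
    (μH[d] : Measure X) (f '' A) ≤ (K : ℝ≥0∞) ^ d * (μH[d] : Measure Y) (g '' A) := by
  rcases A.eq_empty_or_nonempty with rfl | ⟨a, -⟩
  · simp
  have : Nonempty Z := ⟨a⟩
  let i := Function.invFunOn g A
  have hi : ∀ u ∈ A, i (g u) ∈ A ∧ g (i (g u)) = g u := fun u hu =>
    ⟨Function.invFunOn_mem ⟨u, hu, rfl⟩, Function.invFunOn_eq ⟨u, hu, rfl⟩⟩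
  have himg : f '' A = (f ∘ i) '' (g '' A) := by
    rw [image_image]
    refine image_congr fun u hu => ?_
    have := h u hu _ (hi u hu).1
    rw [(hi u hu).2, edist_self, mul_zero] at this
    exact edist_le_zero.1 this
  rw [himg]
  refine LipschitzOnWith.hausdorffMeasure_image_le ?_ hd
  rintro _ ⟨u, hu, rfl⟩ _ ⟨w, hw, rfl⟩
  have := h _ (hi u hu).1 _ (hi w hw).1
  rwa [(hi u hu).2, (hi w hw).2] at this

theorem HasStrictFDerivAt.exists_nhds_edist_comparison {E F : Type*} [NormedAddCommGroup E]
    [NormedSpace ℝ E] [FiniteDimensional ℝ E] [NormedAddCommGroup F] [NormedSpace ℝ F]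
    {f : E → F} {L : E →L[ℝ] F} {x : E} (hf : HasStrictFDerivAt f L x)
    (hL : Function.Injective L) {K : ℝ≥0} (hK : 1 < K) :
    ∃ V ∈ 𝓝 x, ∀ u ∈ V, ∀ w ∈ V, edist (f u) (f w) ≤ K * edist (L u) (L w) ∧
      edist (L u) (L w) ≤ K * edist (f u) (f w) := by
  obtain ⟨C, hC, hLC⟩ := L.toLinearMap.exists_antilipschitzWith (LinearMap.ker_eq_bot.2 hL)
  have hK' : (1 : ℝ) < K := by exact_mod_cast hK
  have hC' : (0 : ℝ) < C := by exact_mod_cast hC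
  have hδ : 0 < (1 - (K : ℝ)⁻¹) / C := div_pos (sub_pos.2 (inv_lt_one_of_one_lt₀ hK')) hC'
  have hev := hf.isLittleO.def hδ
  rw [nhds_prod_eq] at hev
  obtain ⟨V, hV, hVf⟩ := mem_prod_same_iff.1 hev
  refine ⟨V, hV, fun u hu w hw => ?_⟩
  have h1 : ‖f u - f w - L (u - w)‖ ≤ (1 - (K : ℝ)⁻¹) / C * ‖u - w‖ := hVf (mk_mem_prod hu hw)
  have h2 : ‖u - w‖ ≤ C * ‖L u - L w‖ := by
    simpa [dist_eq_norm] using hLC.le_mul_dist u w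
  have h3 : ‖f u - f w - (L u - L w)‖ ≤ (1 - (K : ℝ)⁻¹) * ‖L u - L w‖ := by
    simp only [map_sub] at h1
    refine h1.trans ((mul_le_mul_of_nonneg_left h2 hδ.le).trans_eq ?_)
    field_simp
  have h4 : ‖f u - f w‖ ≤ ‖f u - f w - (L u - L w)‖ + ‖L u - L w‖ := by
    simpa using norm_add_le (f u - f w - (L u - L w)) (L u - L w)
  have h5 : ‖L u - L w‖ ≤ ‖f u - f w‖ + ‖f u - f w - (L u - L w)‖ := by
    simpa using norm_sub_le (f u - f w) (f u - f w - (L u - L w))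
  have h0 := norm_nonneg (L u - L w)
  have hKi : (K : ℝ) * (K : ℝ)⁻¹ = 1 := mul_inv_cancel₀ (by positivity)
  have hK2 : (1 : ℝ) - (K : ℝ)⁻¹ ≤ K - 1 := by nlinarith [inv_pos.2 (zero_lt_one.trans hK')]
  simp only [edist_nndist]
  norm_cast
  simp only [← NNReal.coe_le_coe, NNReal.coe_mul, coe_nndist, dist_eq_norm]
  constructor
  · nlinarith [mul_le_mul_of_nonneg_right hK2 h0]
  · have : (K : ℝ)⁻¹ * ‖L u - L w‖ ≤ ‖f u - f w‖ := by linarith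
    calc ‖L u - L w‖ = K * ((K : ℝ)⁻¹ * ‖L u - L w‖) := by rw [← mul_assoc, hKi, one_mul]
      _ ≤ K * ‖f u - f w‖ := by gcongr

variable {E F : Type*} [NormedAddCommGroup E] [InnerProductSpace ℝ E] [FiniteDimensional ℝ E]
  [NormedAddCommGroup F] [InnerProductSpace ℝ F]

theorem LinearMap.normDet_eq_sqrt_det_gram {ι : Type*} [Fintype ι] [DecidableEq ι] (f : E →ₗ[ℝ] F)
    (b : OrthonormalBasis ι ℝ E) : f.normDet = √(Matrix.gram ℝ (f <| b ·)).det := by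
  rw [← f.normDet_sq_eq_det_gram b]
  exact (Real.sqrt_sq f.normDet_nonneg).symm

theorem continuous_normDet : Continuous fun L : E →L[ℝ] F => L.toLinearMap.normDet := by
  simp_rw [fun L : E →L[ℝ] F => L.toLinearMap.normDet_eq_sqrt_det_gram (stdOrthonormalBasis ℝ E)]
  refine Real.continuous_sqrt.comp (Continuous.matrix_det (continuous_matrix fun i j => ?_))
  simp only [Matrix.gram_apply, ContinuousLinearMap.coe_coe]
  fun_prop

variable [MeasurableSpace E] [BorelSpace E] [MeasurableSpace F] [BorelSpace F]

theorem HasStrictFDerivAt.exists_nhds_hausdorffMeasure_comparison {f : E → F} {x : E}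
    (hf : HasStrictFDerivAt f (fderiv ℝ f x) x) (hf' : ContinuousAt (fderiv ℝ f) x)
    (hinj : Function.Injective (fderiv ℝ f x)) {K : ℝ≥0} (hK : 1 < K) :
    ∃ V, IsOpen V ∧ x ∈ V ∧ ∀ A ⊆ V, MeasurableSet A →
      μH[finrank ℝ E] (f '' A) ≤ (K : ℝ≥0∞) ^ (finrank ℝ E + 1 : ℝ) *
        ∫⁻ y in A, ENNReal.ofReal (fderiv ℝ f y).toLinearMap.normDet ∂μH[finrank ℝ E] ∧
      ∫⁻ y in A, ENNReal.ofReal (fderiv ℝ f y).toLinearMap.normDet ∂μH[finrank ℝ E] ≤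
        (K : ℝ≥0∞) ^ (finrank ℝ E + 1 : ℝ) * μH[finrank ℝ E] (f '' A) := by
  obtain ⟨V₁, hV₁, h₁⟩ := hf.exists_nhds_edist_comparison hinj hK
  set J : E → ℝ := fun y => (fderiv ℝ f y).toLinearMap.normDet with hJ
  have hJc : ContinuousAt J x := continuous_normDet.continuousAt.comp hf'
  have hJx : 0 < J x := lt_of_le_of_ne (LinearMap.normDet_nonneg _)
    (Ne.symm (((LinearMap.normDet_ne_zero_tfae (fderiv ℝ f x).toLinearMap).out 0 4).2 hinj))
  have hK' : (1 : ℝ) < K := by exact_mod_cast hK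
  have hup : ∀ᶠ y in 𝓝 x, J y < K * J x := hJc.eventually_lt_const (by nlinarith)
  have hlow : ∀ᶠ y in 𝓝 x, (K : ℝ)⁻¹ * J x < J y := hJc.eventually_const_lt (by
    nlinarith [inv_lt_one_of_one_lt₀ hK'])
  obtain ⟨V, hVsub, hVo, hxV⟩ := mem_nhds_iff.1 (inter_mem hV₁ (inter_mem hup hlow))
  refine ⟨V, hVo, hxV, fun A hA hAm => ?_⟩
  have hK0 : (K : ℝ≥0∞) ≠ 0 := by simpa using (zero_lt_one.trans hK).ne'
  have hpow : (K : ℝ≥0∞) ^ (finrank ℝ E + 1 : ℝ) = K ^ (finrank ℝ E : ℝ) * K := by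
    rw [ENNReal.rpow_add _ _ hK0 ENNReal.coe_ne_top, ENNReal.rpow_one]
  have hd : (0 : ℝ) ≤ finrank ℝ E := Nat.cast_nonneg _
  have hlin : μH[finrank ℝ E] (fderiv ℝ f x '' A) =
      ENNReal.ofReal (J x) * μH[finrank ℝ E] A :=
    (fderiv ℝ f x).toLinearMap.hausdorffMeasure_image A
  have hconst : ENNReal.ofReal (J x) * μH[finrank ℝ E] A =
      ∫⁻ y in A, ENNReal.ofReal (J x) ∂μH[finrank ℝ E] := by
    rw [setLIntegral_const]
  have hKreal : (K : ℝ≥0∞) = ENNReal.ofReal K := (ENNReal.ofReal_coe_nnreal).symm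
  have hint1 : ENNReal.ofReal (J x) * μH[finrank ℝ E] A ≤
      K * ∫⁻ y in A, ENNReal.ofReal (J y) ∂μH[finrank ℝ E] := by
    rw [hconst, ← lintegral_const_mul' _ _ ENNReal.coe_ne_top]
    refine setLIntegral_mono' hAm fun y hy => ?_
    rw [hKreal, ← ENNReal.ofReal_mul (by positivity)]
    refine ENNReal.ofReal_le_ofReal ?_
    have : (K : ℝ)⁻¹ * J x ≤ J y := le_of_lt (hVsub (hA hy)).2.2
    rwa [inv_mul_le_iff₀ (by positivity)] at this
  have hint2 : ∫⁻ y in A, ENNReal.ofReal (J y) ∂μH[finrank ℝ E] ≤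
      K * (ENNReal.ofReal (J x) * μH[finrank ℝ E] A) := by
    rw [hconst, ← lintegral_const_mul' _ _ ENNReal.coe_ne_top]
    refine setLIntegral_mono' hAm fun y hy => ?_
    rw [hKreal, ← ENNReal.ofReal_mul (by positivity)]
    exact ENNReal.ofReal_le_ofReal (le_of_lt (hVsub (hA hy)).2.1)
  have hl := hausdorffMeasure_image_le_of_edist_le hd (f := f) (g := fderiv ℝ f x) (A := A)
    fun u hu w hw => (h₁ u (hVsub (hA hu)).1 w (hVsub (hA hw)).1).1
  have hr := hausdorffMeasure_image_le_of_edist_le hd (f := fderiv ℝ f x) (g := f) (A := A)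
    fun u hu w hw => (h₁ u (hVsub (hA hu)).1 w (hVsub (hA hw)).1).2
  rw [hlin] at hl hr
  rw [hpow]
  constructor
  · calc _ ≤ _ := hl
      _ ≤ (K : ℝ≥0∞) ^ (finrank ℝ E : ℝ) * (K * _) := by gcongr
      _ = _ := by rw [mul_assoc]
  · calc _ ≤ _ := hint2
      _ ≤ (K : ℝ≥0∞) * ((K : ℝ≥0∞) ^ (finrank ℝ E : ℝ) * _) := by gcongr
      _ = _ := by rw [← mul_assoc, mul_comm (K : ℝ≥0∞)]

/-- **Area formula** for injective `C¹` immersions. -/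
theorem hausdorffMeasure_image_eq_lintegral_normDet {f : E → F} {s : Set E} (hs : IsOpen s)
    (hf : ContDiffOn ℝ 1 f s) (hinj : InjOn f s)
    (hf' : ∀ x ∈ s, Function.Injective (fderiv ℝ f x)) {A : Set E} (hA : MeasurableSet A)
    (hAs : A ⊆ s) :
    μH[finrank ℝ E] (f '' A) =
      ∫⁻ y in A, ENNReal.ofReal (fderiv ℝ f y).toLinearMap.normDet ∂μH[finrank ℝ E] := by
  set d : ℝ := (finrank ℝ E : ℝ) with hd
  have key : ∀ K : ℝ≥0, 1 < K → μH[d] (f '' A) ≤ (K : ℝ≥0∞) ^ (d + 1 : ℝ) *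
        ∫⁻ y in A, ENNReal.ofReal (fderiv ℝ f y).toLinearMap.normDet ∂μH[d] ∧
      ∫⁻ y in A, ENNReal.ofReal (fderiv ℝ f y).toLinearMap.normDet ∂μH[d] ≤
        (K : ℝ≥0∞) ^ (d + 1 : ℝ) * μH[d] (f '' A) := by
    intro K hK
    rcases A.eq_empty_or_nonempty with rfl | hne
    · simp
    have hloc : ∀ x ∈ s, ∃ V, IsOpen V ∧ x ∈ V ∧ ∀ A ⊆ V, MeasurableSet A →
        μH[d] (f '' A) ≤ (K : ℝ≥0∞) ^ (d + 1 : ℝ) *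
          ∫⁻ y in A, ENNReal.ofReal (fderiv ℝ f y).toLinearMap.normDet ∂μH[d] ∧
        ∫⁻ y in A, ENNReal.ofReal (fderiv ℝ f y).toLinearMap.normDet ∂μH[d] ≤
          (K : ℝ≥0∞) ^ (d + 1 : ℝ) * μH[d] (f '' A) := fun x hx =>
      ((hf.contDiffAt (hs.mem_nhds hx)).hasStrictFDerivAt one_ne_zero
        ).exists_nhds_hausdorffMeasure_comparison
          ((hf.continuousOn_fderiv_of_isOpen hs le_rfl).continuousAt (hs.mem_nhds hx))
          (hf' x hx) hK
    choose! V hVo hxV hV using hloc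
    obtain ⟨t, hts, htc, hcov⟩ := TopologicalSpace.countable_cover_nhdsWithin
      (fun x hx => mem_nhdsWithin_of_mem_nhds ((hVo x hx).mem_nhds (hxV x hx)) :
        ∀ x ∈ s, V x ∈ 𝓝[s] x)
    have htne : t.Nonempty := by
      obtain ⟨a, ha⟩ := hne
      obtain ⟨x, hx, -⟩ := mem_iUnion₂.1 (hcov (hAs ha))
      exact ⟨x, hx⟩
    obtain ⟨p, rfl⟩ := htc.exists_eq_range htne
    let B : ℕ → Set E := fun n => A ∩ disjointed (fun n => V (p n)) n
    have hBA : ⋃ n, B n = A := by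
      rw [← inter_iUnion, iUnion_disjointed, inter_eq_left]
      exact hAs.trans (by simpa using hcov)
    have hps : ∀ n, p n ∈ s := fun n => hts (mem_range_self n)
    have hBm : ∀ n, MeasurableSet (B n) := fun n =>
      hA.inter (MeasurableSet.disjointed (fun n => (hVo _ (hps n)).measurableSet) n)
    have hBV : ∀ n, B n ⊆ V (p n) := fun n => inter_subset_right.trans (disjointed_subset _ _)
    have hBd : Pairwise (Function.onFun Disjoint B) := fun m n hmn =>
      (disjoint_disjointed _ hmn).mono inter_subset_right inter_subset_right
    have hsum1 : μH[d] (f '' A) = ∑' n, μH[d] (f '' B n) := by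
      rw [← hBA, image_iUnion, measure_iUnion]
      · exact fun m n hmn => disjoint_image_image fun b hb c hc hbc =>
          disjoint_left.1 (hBd hmn) hb (hinj (hAs hb.1) (hAs hc.1) hbc ▸ hc)
      · exact fun n => (hBm n).image_of_continuousOn_injOn
          (hf.continuousOn.mono (inter_subset_left.trans hAs))
          (hinj.mono (inter_subset_left.trans hAs))
    have hsum2 : ∫⁻ y in A, ENNReal.ofReal (fderiv ℝ f y).toLinearMap.normDet ∂μH[d] =
        ∑' n, ∫⁻ y in B n, ENNReal.ofReal (fderiv ℝ f y).toLinearMap.normDet ∂μH[d] := by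
      rw [← lintegral_iUnion hBm hBd, hBA]
    rw [hsum1, hsum2, ← ENNReal.tsum_mul_left, ← ENNReal.tsum_mul_left]
    exact ⟨ENNReal.tsum_le_tsum fun n => (hV _ (hps n) _ (hBV n) (hBm n)).1,
      ENNReal.tsum_le_tsum fun n => (hV _ (hps n) _ (hBV n) (hBm n)).2⟩
  have hlim : ∀ a : ℝ≥0∞, Tendsto (fun K : ℝ≥0 => (K : ℝ≥0∞) ^ (d + 1 : ℝ) * a)
      (𝓝[>] (1 : ℝ≥0)) (𝓝 a) := by
    intro a
    have h1 : Tendsto (fun K : ℝ≥0 => (K : ℝ≥0∞) ^ (d + 1 : ℝ)) (𝓝[>] (1 : ℝ≥0)) (𝓝 1) := by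
      have : Continuous fun K : ℝ≥0 => (K : ℝ≥0∞) ^ (d + 1 : ℝ) :=
        (ENNReal.continuous_rpow_const).comp ENNReal.continuous_coe
      simpa using (this.tendsto 1).mono_left nhdsWithin_le_nhds
    simpa using ENNReal.Tendsto.mul_const h1 (Or.inl one_ne_zero)
  exact le_antisymm
    (ge_of_tendsto (hlim _) (eventually_mem_nhdsWithin.mono fun K hK => (key K hK).1))
    (ge_of_tendsto (hlim _) (eventually_mem_nhdsWithin.mono fun K hK => (key K hK).2))

/-- Change of variables along an injective `C¹` immersion. -/
theorem setIntegral_image_hausdorffMeasure {G : Type*} [NormedAddCommGroup G] [NormedSpace ℝ G]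
    {f : E → F} {s : Set E} (hs : IsOpen s) (hf : ContDiff ℝ 1 f) (hinj : InjOn f s)
    (hf' : ∀ x ∈ s, Function.Injective (fderiv ℝ f x)) {h : F → G}
    (hh : AEStronglyMeasurable h (μH[finrank ℝ E].restrict (f '' s))) :
    ∫ x in f '' s, h x ∂μH[finrank ℝ E] =
      ∫ y in s, (fderiv ℝ f y).toLinearMap.normDet • h (f y) ∂μH[finrank ℝ E] := by
  have hJ : Measurable fun y => ENNReal.ofReal (fderiv ℝ f y).toLinearMap.normDet :=
    (continuous_normDet.comp (hf.continuous_fderiv one_ne_zero)).measurable.ennreal_ofReal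
  have hfm : Measurable f := hf.continuous.measurable
  have hmap : μH[finrank ℝ E].restrict (f '' s) =
      Measure.map f ((μH[finrank ℝ E].restrict s).withDensity
        fun y => ENNReal.ofReal (fderiv ℝ f y).toLinearMap.normDet) := by
    ext B hB
    rw [Measure.restrict_apply hB, Measure.map_apply hfm hB, withDensity_apply _ (hfm hB),
      Measure.restrict_restrict (hfm hB), ← image_preimage_inter,
      hausdorffMeasure_image_eq_lintegral_normDet hs hf.contDiffOn hinj hf'
        ((hfm hB).inter hs.measurableSet) inter_subset_right]
  rw [hmap] at hh ⊢
  rw [integral_map hfm.aemeasurable hh, integral_withDensity_eq_integral_toReal_smul hJ (by simp)]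
  simp [LinearMap.normDet_nonneg]

end AreaFormula

section SurfaceDivergence

open Set Filter Module Topology

theorem integral_fderiv_apply_eq_zero_of_hasCompactSupport {E : Type*} [NormedAddCommGroup E]
    [NormedSpace ℝ E] [FiniteDimensional ℝ E] [MeasurableSpace E] [BorelSpace E] {μ : Measure E}
    [μ.IsAddHaarMeasure] {F : E → ℝ} (hF : ContDiff ℝ 1 F) (hc : HasCompactSupport F) (e : E) :
    ∫ x, fderiv ℝ F x e ∂μ = 0 := by
  have hint : Integrable (fun x => fderiv ℝ F x e) μ :=
    ((hF.continuous_fderiv one_ne_zero).clm_apply continuous_const).integrable_of_hasCompactSupport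
      (hc.fderiv_apply ℝ e)
  have := integral_mul_fderiv_eq_neg_fderiv_mul_of_integrable (μ := μ) (f := fun _ : E => (1 : ℝ))
    (g := F) (v := e) (by simp) (by simpa using hint)
    (by simpa using hF.continuous.integrable_of_hasCompactSupport hc) (by simp)
    (fun x _ => hF.differentiable one_ne_zero x)
  simpa using this

theorem setIntegral_fderiv_apply_eq_zero {E : Type*} [NormedAddCommGroup E]
    [NormedSpace ℝ E] [FiniteDimensional ℝ E] [MeasurableSpace E] [BorelSpace E] {μ : Measure E}
    [μ.IsAddHaarMeasure] {F : E → ℝ} (hF : ContDiff ℝ 1 F) {U K : Set E} (hU : IsOpen U)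
    (hK : IsCompact K) (hKU : K ⊆ U) (hzero : ∀ x ∈ U \ K, F x = 0) (e : E) :
    IntegrableOn (fun x => fderiv ℝ F x e) U μ ∧ ∫ x in U, fderiv ℝ F x e ∂μ = 0 := by
  have hin : ∀ x ∈ U, U.indicator F =ᶠ[𝓝 x] F := fun x hx =>
    eventuallyEq_of_mem (hU.mem_nhds hx) fun y hy => indicator_of_mem hy F
  have hzero' : ∀ x ∉ K, U.indicator F x = 0 := fun x hx => by
    by_cases hxU : x ∈ U
    · rw [indicator_of_mem hxU, hzero x ⟨hxU, hx⟩]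
    · exact indicator_of_notMem hxU F
  have hout : ∀ x ∉ U, U.indicator F =ᶠ[𝓝 x] fun _ => 0 := fun x hx =>
    eventuallyEq_of_mem (hK.isClosed.isOpen_compl.mem_nhds fun h => hx (hKU h)) hzero'
  have hsmooth : ContDiff ℝ 1 (U.indicator F) := contDiff_iff_contDiffAt.2 fun x => by
    by_cases hx : x ∈ U
    · exact hF.contDiffAt.congr_of_eventuallyEq (hin x hx)
    · exact contDiffAt_const.congr_of_eventuallyEq (hout x hx)
  have hcs : HasCompactSupport (U.indicator F) := HasCompactSupport.intro hK hzero'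
  have hderiv : (U.indicator fun x => fderiv ℝ F x e) =
      fun x => fderiv ℝ (U.indicator F) x e := by
    ext x
    by_cases hx : x ∈ U
    · rw [indicator_of_mem hx, (hin x hx).fderiv_eq]
    · rw [indicator_of_notMem hx, (hout x hx).fderiv_eq]
      simp
  constructor
  · rw [← integrable_indicator_iff hU.measurableSet, hderiv]
    exact ((hsmooth.continuous_fderiv one_ne_zero).clm_apply
      continuous_const).integrable_of_hasCompactSupport (hcs.fderiv_apply ℝ e)
  · rw [← integral_indicator hU.measurableSet, hderiv]
    exact integral_fderiv_apply_eq_zero_of_hasCompactSupport hsmooth hcs e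

/-- The scalar triple product on ℝ³. -/
def triple3 (a b c : E3) : ℝ := dot3 (cross3 a b) c

theorem cross3_apply_zero (a b : E3) : cross3 a b 0 = a 1 * b 2 - a 2 * b 1 := rfl
theorem cross3_apply_one (a b : E3) : cross3 a b 1 = a 2 * b 0 - a 0 * b 2 := rfl
theorem cross3_apply_two (a b : E3) : cross3 a b 2 = a 0 * b 1 - a 1 * b 0 := rfl

theorem triple3_def (a b c : E3) : triple3 a b c =
    (a 1 * b 2 - a 2 * b 1) * c 0 + (a 2 * b 0 - a 0 * b 2) * c 1
      + (a 0 * b 1 - a 1 * b 0) * c 2 := by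
  simp [triple3, dot3, Fin.sum_univ_three, cross3_apply_zero, cross3_apply_one, cross3_apply_two]

theorem dot3_def (a b : E3) : dot3 a b = a 0 * b 0 + a 1 * b 1 + a 2 * b 2 := by
  simp [dot3, Fin.sum_univ_three]

theorem dot3_self (a : E3) : dot3 a a = ‖a‖ ^ 2 := by
  rw [EuclideanSpace.norm_sq_eq]
  simp [dot3, sq]

theorem contDiff_euclidean_apply {E : Type*} [NormedAddCommGroup E] [NormedSpace ℝ E] {n : WithTop ℕ∞}
    {a : E → E3} (ha : ContDiff ℝ n a) (i : Fin 3) : ContDiff ℝ n fun x => a x i :=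
  (EuclideanSpace.proj (𝕜 := ℝ) i).contDiff.comp ha

theorem HasDerivAt.euclidean_apply {a : ℝ → E3} {a' : E3} {s : ℝ} (ha : HasDerivAt a a' s)
    (i : Fin 3) : HasDerivAt (fun r => a r i) (a' i) s :=
  (EuclideanSpace.proj (𝕜 := ℝ) i).hasFDerivAt.comp_hasDerivAt s ha

theorem ContDiff.triple3 {E : Type*} [NormedAddCommGroup E] [NormedSpace ℝ E] {n : WithTop ℕ∞}
    {a b c : E → E3} (ha : ContDiff ℝ n a) (hb : ContDiff ℝ n b) (hc : ContDiff ℝ n c) :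
    ContDiff ℝ n fun x => triple3 (a x) (b x) (c x) := by
  simp only [triple3_def]
  have hA := contDiff_euclidean_apply ha
  have hB := contDiff_euclidean_apply hb
  have hC := contDiff_euclidean_apply hc
  exact ((((hA 1).mul (hB 2)).sub ((hA 2).mul (hB 1))).mul (hC 0)).add
    ((((hA 2).mul (hB 0)).sub ((hA 0).mul (hB 2))).mul (hC 1)) |>.add
    ((((hA 0).mul (hB 1)).sub ((hA 1).mul (hB 0))).mul (hC 2))

theorem fderiv_triple3_apply {E : Type*} [NormedAddCommGroup E] [NormedSpace ℝ E]
    {a b c : E → E3} (ha : ContDiff ℝ 1 a) (hb : ContDiff ℝ 1 b) (hc : ContDiff ℝ 1 c) (x e : E) :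
    fderiv ℝ (fun x => triple3 (a x) (b x) (c x)) x e =
      triple3 (fderiv ℝ a x e) (b x) (c x) + triple3 (a x) (fderiv ℝ b x e) (c x) +
        triple3 (a x) (b x) (fderiv ℝ c x e) := by
  have hline : ∀ {G : Type} [NormedAddCommGroup G] [NormedSpace ℝ G] {u : E → G},
      ContDiff ℝ 1 u → HasDerivAt (fun s : ℝ => u (x + s • e)) (fderiv ℝ u x e) 0 :=
    fun hu => (hu.differentiable one_ne_zero x).hasFDerivAt.hasLineDerivAt e
  have hA := (hline ha).euclidean_apply
  have hB := (hline hb).euclidean_apply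
  have hC := (hline hc).euclidean_apply
  refine (hline (ha.triple3 hb hc)).unique ?_
  simp only [triple3_def]
  refine ((((((hA 1).mul (hB 2)).sub ((hA 2).mul (hB 1))).mul (hC 0)).add
    ((((hA 2).mul (hB 0)).sub ((hA 0).mul (hB 2))).mul (hC 1))).add
    ((((hA 0).mul (hB 1)).sub ((hA 1).mul (hB 0))).mul (hC 2))).congr_deriv ?_
  simp only [zero_smul, add_zero, Pi.mul_apply, Pi.sub_apply]
  ring

theorem triple3_eq_zero_of_orthogonal {a b c n : E3} (hn : dot3 n n = 1) (ha : dot3 a n = 0)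
    (hb : dot3 b n = 0) (hc : dot3 c n = 0) : triple3 a b c = 0 := by
  simp only [triple3_def, dot3_def] at *
  linear_combination (-((a 1 * b 2 - a 2 * b 1) * c 0 + (a 2 * b 0 - a 0 * b 2) * c 1
      + (a 0 * b 1 - a 1 * b 0) * c 2)) * hn
    + ((b 1 * c 2 - b 2 * c 1) * n 0 + (b 2 * c 0 - b 0 * c 2) * n 1
      + (b 0 * c 1 - b 1 * c 0) * n 2) * ha
    + ((c 1 * a 2 - c 2 * a 1) * n 0 + (c 2 * a 0 - c 0 * a 2) * n 1
      + (c 0 * a 1 - c 1 * a 0) * n 2) * hb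
    + ((a 1 * b 2 - a 2 * b 1) * n 0 + (a 2 * b 0 - a 0 * b 2) * n 1
      + (a 0 * b 1 - a 1 * b 0) * n 2) * hc

theorem E3.eq_sum_single (a : E3) : a = ∑ j, a j • EuclideanSpace.single j (1 : ℝ) := by
  ext i
  fin_cases i <;> simp [Fin.sum_univ_three]

theorem pdx_apply_eq {W : E3 × ℝ → E3} {t : ℝ} {x : E3}
    (hW : DifferentiableAt ℝ (fun y => W (y, t)) x) (i j : Fin 3) :
    pdx i (fun p => W p j) x t =
      fderiv ℝ (fun y => W (y, t)) x (EuclideanSpace.single i 1) j := by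
  have : HasFDerivAt (fun y => W (y, t) j)
      ((EuclideanSpace.proj (𝕜 := ℝ) j).comp (fderiv ℝ (fun y => W (y, t)) x)) x :=
    (EuclideanSpace.proj (𝕜 := ℝ) j).hasFDerivAt.comp x hW.hasFDerivAt
  rw [pdx, this.fderiv]
  rfl

/-- For a linear map `A`, the variation of the area element under `A` is `tr A - n · A n`. -/
theorem triple3_add_triple3_eq (A : E3 →L[ℝ] E3) {a b n : E3} {J : ℝ}
    (hn : dot3 n n = 1) (hJ : cross3 a b = J • n) :
    triple3 (A a) b n + triple3 a (A b) n =
      J * ∑ j, ∑ i, ((if i = j then (1 : ℝ) else 0) - n i * n j) *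
        A (EuclideanSpace.single i 1) j := by
  have h0 : a 1 * b 2 - a 2 * b 1 = J * n 0 := congrArg (fun u : E3 => u 0) hJ
  have h1 : a 2 * b 0 - a 0 * b 2 = J * n 1 := congrArg (fun u : E3 => u 1) hJ
  have h2 : a 0 * b 1 - a 1 * b 0 = J * n 2 := congrArg (fun u : E3 => u 2) hJ
  have hA : ∀ (u : E3) (i : Fin 3), A u i = ∑ j, u j * A (EuclideanSpace.single j 1) i := by
    intro u i
    conv_lhs => rw [E3.eq_sum_single u]
    simp [map_smul, Fin.sum_univ_three]
  simp only [triple3_def, dot3_def] at *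
  rw [hA a 0, hA a 1, hA a 2, hA b 0, hA b 1, hA b 2]
  simp only [Fin.sum_univ_three, Fin.isValue, Fin.reduceEq, if_true, if_false]
  generalize A (EuclideanSpace.single 0 1) = c₀
  generalize A (EuclideanSpace.single 1 1) = c₁
  generalize A (EuclideanSpace.single 2 1) = c₂
  have htr : J * (c₀ 0 + c₁ 1 + c₂ 2) =
      (c₀ 0 + c₁ 1 + c₂ 2) * ((a 1 * b 2 - a 2 * b 1) * n 0 + (a 2 * b 0 - a 0 * b 2) * n 1
      + (a 0 * b 1 - a 1 * b 0) * n 2) := by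
    rw [h0, h1, h2]; linear_combination (-J * (c₀ 0 + c₁ 1 + c₂ 2)) * hn
  linear_combination (-1) * htr
    + (-(c₀ 0 * n 0 + c₁ 0 * n 1 + c₂ 0 * n 2)) * h0
    + (-(c₀ 1 * n 0 + c₁ 1 * n 1 + c₂ 1 * n 2)) * h1
    + (-(c₀ 2 * n 0 + c₁ 2 * n 1 + c₂ 2 * n 2)) * h2

theorem normDet_eq_norm_cross3 (L : E2 →L[ℝ] E3) : L.toLinearMap.normDet =
    ‖cross3 (L (EuclideanSpace.single 0 1)) (L (EuclideanSpace.single 1 1))‖ := by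
  rw [L.toLinearMap.normDet_eq_sqrt_det_gram (EuclideanSpace.basisFun (Fin 2) ℝ),
    ← Real.sqrt_sq (norm_nonneg (cross3 _ _)), ← dot3_self]
  congr 1
  simp only [Matrix.det_fin_two, Matrix.gram_apply, EuclideanSpace.basisFun_apply,
    ContinuousLinearMap.coe_coe, PiLp.inner_apply, Fin.sum_univ_three, dot3_def,
    cross3_apply_zero, cross3_apply_one, cross3_apply_two, RCLike.inner_apply, conj_trivial]
  ring

/-- The surface divergence of a compactly supported tangential field integrates to zero. -/
theorem setIntegral_sdiv_eq_zero {f : E2 → E3} (hf : ContDiff ℝ 2 f) {U K : Set E2}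
    (hU : IsOpen U) (hinj : InjOn f U) (hK : IsCompact K) (hKU : K ⊆ U)
    (hreg : ∀ X ∈ U, cross3 (fderiv ℝ f X (EuclideanSpace.single 0 1))
      (fderiv ℝ f X (EuclideanSpace.single 1 1)) ≠ 0)
    {N W : E3 × ℝ → E3} {t : ℝ} (hN : ContDiff ℝ 1 fun x => N (x, t))
    (hW : ContDiff ℝ 1 fun x => W (x, t))
    (hNs : ∀ X ∈ U, cross3 (fderiv ℝ f X (EuclideanSpace.single 0 1))
      (fderiv ℝ f X (EuclideanSpace.single 1 1)) =
      ‖cross3 (fderiv ℝ f X (EuclideanSpace.single 0 1))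
        (fderiv ℝ f X (EuclideanSpace.single 1 1))‖ • N (f X, t))
    (hunit : ∀ X ∈ U, dot3 (N (f X, t)) (N (f X, t)) = 1)
    (htan : ∀ X ∈ U, dot3 (W (f X, t)) (N (f X, t)) = 0)
    (hzero : ∀ X ∈ U \ K, W (f X, t) = 0) :
    ∫ x in f '' U, sdiv N W x t ∂(μH[2] : Measure E3) = 0 := by
  set e : Fin 2 → E2 := fun α => EuclideanSpace.single α 1 with he
  have hf1 : ContDiff ℝ 1 f := hf.of_le one_le_two
  have hg : ∀ α, ContDiff ℝ 1 fun X => fderiv ℝ f X (e α) := fun α =>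
    (hf.fderiv_right (m := 1) (by norm_num)).clm_apply contDiff_const
  have hn : ContDiff ℝ 1 fun X => N (f X, t) := hN.comp hf1
  have hw : ContDiff ℝ 1 fun X => W (f X, t) := hW.comp hf1
  have hrank : ((finrank ℝ E2 : ℕ) : ℝ) = 2 := by simp
  have hhaar : (μH[2] : Measure E2).IsAddHaarMeasure := by
    rw [← hrank]; infer_instance
  have hinjd : ∀ X ∈ U, Function.Injective (fderiv ℝ f X) := fun X hX =>
    ((LinearMap.normDet_ne_zero_tfae (fderiv ℝ f X).toLinearMap).out 0 4).1 (by
      rw [normDet_eq_norm_cross3]; exact norm_ne_zero_iff.2 (hreg X hX))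
  have hcont : Continuous fun x => sdiv N W x t := by
    simp only [_root_.sdiv, tder, fun x i j =>
      pdx_apply_eq ((hW.differentiable one_ne_zero) x) i j]
    have h1 := contDiff_euclidean_apply hN
    have h2 := fun i => contDiff_euclidean_apply (n := 0)
      (contDiff_zero.2 ((hW.continuous_fderiv one_ne_zero).clm_apply
        (continuous_const (y := EuclideanSpace.single i (1 : ℝ)))))
    refine continuous_finsetSum _ fun j _ => continuous_finsetSum _ fun i _ => ?_
    exact (continuous_const.sub ((h1 i).continuous.mul (h1 j).continuous)).mul
      (h2 i j).continuous
  have hchange := setIntegral_image_hausdorffMeasure hU hf1 hinj hinjd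
    (h := fun x => sdiv N W x t) hcont.aestronglyMeasurable
  rw [hrank] at hchange
  rw [hchange]
  have hF₀ : ContDiff ℝ 1 fun X => triple3 (W (f X, t)) (fderiv ℝ f X (e 1)) (N (f X, t)) :=
    hw.triple3 (hg 1) hn
  have hF₁ : ContDiff ℝ 1 fun X => triple3 (fderiv ℝ f X (e 0)) (W (f X, t)) (N (f X, t)) :=
    (hg 0).triple3 hw hn
  obtain ⟨hi₀, hz₀⟩ := setIntegral_fderiv_apply_eq_zero (μ := (μH[2] : Measure E2)) hF₀ hU hK hKU
    (fun X hX => by simp [triple3_def, hzero X hX]) (e 0)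
  obtain ⟨hi₁, hz₁⟩ := setIntegral_fderiv_apply_eq_zero (μ := (μH[2] : Measure E2)) hF₁ hU hK hKU
    (fun X hX => by simp [triple3_def, hzero X hX]) (e 1)
  rw [← add_zero (0 : ℝ)]
  nth_rw 1 [← hz₀]
  rw [← hz₁, ← integral_add hi₀ hi₁]
  refine setIntegral_congr_fun hU.measurableSet fun X hX => ?_
  beta_reduce
  have hNn : ∀ u, dot3 (fderiv ℝ (fun X => N (f X, t)) X u) (N (f X, t)) = 0 := by
    intro u
    have hline : HasDerivAt (fun s : ℝ => N (f (X + s • u), t))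
        (fderiv ℝ (fun X => N (f X, t)) X u) 0 :=
      (hn.differentiable one_ne_zero X).hasFDerivAt.hasLineDerivAt u
    have h1 : (fun s : ℝ => dot3 (N (f (X + s • u), t)) (N (f (X + s • u), t)))
        =ᶠ[𝓝 0] fun _ => 1 := by
      have : Continuous fun s : ℝ => X + s • u := by fun_prop
      have hmem : ∀ᶠ s in 𝓝 (0 : ℝ), X + s • u ∈ U :=
        this.continuousAt.eventually_mem (hU.mem_nhds (by simpa using hX))
      exact hmem.mono fun s hs => hunit _ hs
    have h2 := (hasDerivAt_const (0 : ℝ) (1 : ℝ)).congr_of_eventuallyEq h1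
    have hc := hline.euclidean_apply
    simp only [dot3_def] at h2 ⊢
    have h3 := h2.unique ((((hc 0).mul (hc 0)).add ((hc 1).mul (hc 1))).add
      ((hc 2).mul (hc 2)))
    simp only [zero_smul, add_zero] at h3
    linarith
  have hsymm : fderiv ℝ (fun X => fderiv ℝ f X (e 1)) X (e 0) =
      fderiv ℝ (fun X => fderiv ℝ f X (e 0)) X (e 1) := by
    have hd : DifferentiableAt ℝ (fderiv ℝ f) X :=
      (hf.fderiv_right (m := 1) (by norm_num)).differentiable one_ne_zero X
    have hs := (hf.contDiffAt (x := X)).isSymmSndFDerivAt (by simp)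
    rw [fderiv_clm_apply hd (differentiableAt_const _),
      fderiv_clm_apply hd (differentiableAt_const _)]
    simpa using hs (e 0) (e 1)
  have hchain : ∀ u, fderiv ℝ (fun X => W (f X, t)) X u =
      fderiv ℝ (fun x => W (x, t)) (f X) (fderiv ℝ f X u) := fun u => by
    have := fderiv_comp X (hW.differentiable one_ne_zero (f X)) (hf1.differentiable one_ne_zero X)
    exact congrArg (fun L : E2 →L[ℝ] E3 => L u) this
  have hgn : ∀ α, dot3 (fderiv ℝ f X (e α)) (N (f X, t)) = 0 := by
    intro α
    have hc := hNs X hX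
    have hne := norm_ne_zero_iff.2 (hreg X hX)
    refine (mul_eq_zero.1 (?_ : ‖cross3 (fderiv ℝ f X (e 0)) (fderiv ℝ f X (e 1))‖ *
      dot3 (fderiv ℝ f X (e α)) (N (f X, t)) = 0)).resolve_left hne
    have : ∀ i, ‖cross3 (fderiv ℝ f X (e 0)) (fderiv ℝ f X (e 1))‖ * N (f X, t) i =
        cross3 (fderiv ℝ f X (e 0)) (fderiv ℝ f X (e 1)) i := fun i =>
      (congrArg (fun u : E3 => u i) hc).symm
    have h0 := this 0
    have h1 := this 1
    have h2 := this 2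
    rw [cross3_apply_zero] at h0
    rw [cross3_apply_one] at h1
    rw [cross3_apply_two] at h2
    simp only [dot3_def]
    obtain rfl | rfl : α = 0 ∨ α = 1 := by fin_cases α <;> simp
    · linear_combination (fderiv ℝ f X (e 0) 0) * h0 + (fderiv ℝ f X (e 0) 1) * h1 +
        (fderiv ℝ f X (e 0) 2) * h2
    · linear_combination (fderiv ℝ f X (e 1) 0) * h0 + (fderiv ℝ f X (e 1) 1) * h1 +
        (fderiv ℝ f X (e 1) 2) * h2
  rw [fderiv_triple3_apply hw (hg 1) hn, fderiv_triple3_apply (hg 0) hw hn,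
    triple3_eq_zero_of_orthogonal (hunit X hX) (htan X hX) (hgn 1) (hNn (e 0)),
    triple3_eq_zero_of_orthogonal (hunit X hX) (hgn 0) (htan X hX) (hNn (e 1)),
    hsymm, hchain, hchain, normDet_eq_norm_cross3, smul_eq_mul]
  have hanti : triple3 (W (f X, t)) (fderiv ℝ (fun X => fderiv ℝ f X (e 0)) X (e 1)) (N (f X, t)) =
      -triple3 (fderiv ℝ (fun X => fderiv ℝ f X (e 0)) X (e 1)) (W (f X, t)) (N (f X, t)) := by
    simp only [triple3_def]; ring
  have hmain := triple3_add_triple3_eq (fderiv ℝ (fun x => W (x, t)) (f X)) (hunit X hX) (hNs X hX)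
  simp only [_root_.sdiv, tder, fun i j => pdx_apply_eq ((hW.differentiable one_ne_zero) (f X)) i j]
  rw [← hmain, hanti]
  ring

end SurfaceDivergence

section DissipationEnergy

open Set Filter Module Topology

theorem hausdorffMeasure_two_image_lt_top {f : E2 → E3} (hf : ContDiff ℝ 1 f) {U : Set E2}
    (hU : Bornology.IsBounded U) : (μH[2] : Measure E3) (f '' U) < ⊤ := by
  obtain ⟨R, hR⟩ := hU.subset_closedBall 0
  obtain ⟨C, hC⟩ := hf.contDiffOn.exists_lipschitzOnWith one_ne_zero
    (convex_closedBall (0 : E2) R) (isCompact_closedBall _ _)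
  have hrank : ((finrank ℝ E2 : ℕ) : ℝ) = 2 := by simp
  have hhaar : (μH[2] : Measure E2).IsAddHaarMeasure := by
    rw [← hrank]; infer_instance
  refine ((hC.mono hR).hausdorffMeasure_image_le zero_le_two).trans_lt ?_
  exact ENNReal.mul_lt_top (by simp) hU.measure_lt_top

theorem hasDerivAt_integral_of_continuous_of_compact {X : Type*} [TopologicalSpace X]
    [MeasurableSpace X] [OpensMeasurableSpace X] [SecondCountableTopology X] {ν : Measure X}
    [IsFiniteMeasure ν] {C : Set X} (hC : IsCompact C) (hν : ∀ᵐ x ∂ν, x ∈ C)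
    {F F' : ℝ → X → ℝ} (hF : ∀ s, Continuous (F s)) (hF' : Continuous fun p : ℝ × X => F' p.1 p.2)
    (hd : ∀ s x, HasDerivAt (fun r => F r x) (F' s x) s) (s₀ : ℝ) :
    HasDerivAt (fun s => ∫ x, F s x ∂ν) (∫ x, F' s₀ x ∂ν) s₀ := by
  obtain ⟨b, hb⟩ := ((isCompact_closedBall s₀ 1).prod hC).exists_bound_of_continuousOn
    hF'.continuousOn
  obtain ⟨b₀, hb₀⟩ := hC.exists_bound_of_continuousOn (hF s₀).continuousOn
  refine (hasDerivAt_integral_of_dominated_loc_of_deriv_le (bound := fun _ => b)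
    (Metric.ball_mem_nhds s₀ one_pos) (.of_forall fun s => (hF s).aestronglyMeasurable)
    (Integrable.of_bound (hF s₀).aestronglyMeasurable b₀ (hν.mono hb₀)) ?_
    (hν.mono fun x hx s hs => hb (s, x) ⟨Metric.ball_subset_closedBall hs, hx⟩)
    (integrable_const b) (.of_forall fun x s _ => hd s x)).2
  exact (hF'.comp (Continuous.prodMk_right s₀)).aestronglyMeasurable

theorem contDiff_pdx {n : WithTop ℕ∞} {w : E3 × ℝ → E3} {t : ℝ}
    (hw : ContDiff ℝ (n + 1) fun x => w (x, t)) (i j : Fin 3) :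
    ContDiff ℝ n fun x => pdx i (fun p => w p j) x t := by
  have hd : Differentiable ℝ fun x => w (x, t) := hw.differentiable (by simp)
  simp only [fun x => pdx_apply_eq (hd x) i j]
  exact contDiff_euclidean_apply ((hw.fderiv_right le_rfl).clm_apply contDiff_const) j

theorem contDiff_Pmat {n : WithTop ℕ∞} {N : E3 × ℝ → E3} {t : ℝ}
    (hN : ContDiff ℝ n fun x => N (x, t)) (i j : Fin 3) :
    ContDiff ℝ n fun x => Pmat N x t i j :=
  contDiff_const.sub ((contDiff_euclidean_apply hN i).mul (contDiff_euclidean_apply hN j))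

theorem contDiff_DGam {n : WithTop ℕ∞} {N w : E3 × ℝ → E3} {t : ℝ}
    (hN : ContDiff ℝ n fun x => N (x, t)) (hw : ContDiff ℝ (n + 1) fun x => w (x, t))
    (i j : Fin 3) : ContDiff ℝ n fun x => DGam N w x t i j := by
  simp only [DGam, Matrix.mul_apply]
  refine ContDiff.sum fun k _ => (ContDiff.sum fun l _ => ?_).mul (contDiff_Pmat hN k j)
  exact (contDiff_Pmat hN i l).mul (((contDiff_pdx hw l k).add (contDiff_pdx hw k l)).div_const 2)

theorem contDiff_sdiv {n : WithTop ℕ∞} {N w : E3 × ℝ → E3} {t : ℝ}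
    (hN : ContDiff ℝ n fun x => N (x, t)) (hw : ContDiff ℝ (n + 1) fun x => w (x, t)) :
    ContDiff ℝ n fun x => _root_.sdiv N w x t := by
  simp only [_root_.sdiv, tder]
  exact ContDiff.sum fun j _ => ContDiff.sum fun i _ =>
    (contDiff_Pmat hN i j).mul (contDiff_pdx hw i j)

theorem ContDiff.frob2 {E : Type*} [NormedAddCommGroup E] [NormedSpace ℝ E] {n : WithTop ℕ∞}
    {A : E → Matrix (Fin 3) (Fin 3) ℝ} (hA : ∀ i j, ContDiff ℝ n fun x => A x i j) :
    ContDiff ℝ n fun x => frob2 (A x) :=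
  ContDiff.sum fun i _ => ContDiff.sum fun j _ => (hA i j).pow 2

theorem pdx_add_smul {v w : E3 × ℝ → E3} {x : E3} {t : ℝ}
    (hv : DifferentiableAt ℝ (fun y => v (y, t)) x) (hw : DifferentiableAt ℝ (fun y => w (y, t)) x)
    (s : ℝ) (i j : Fin 3) : pdx i (fun p => (v p + s • w p) j) x t =
      pdx i (fun p => v p j) x t + s * pdx i (fun p => w p j) x t := by
  have h : HasFDerivAt (fun y => v (y, t) + s • w (y, t)) _ x :=
    hv.hasFDerivAt.add (hw.hasFDerivAt.const_smul s)
  rw [pdx_apply_eq hv, pdx_apply_eq hw,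
    pdx_apply_eq (W := fun p => v p + s • w p) h.differentiableAt, h.fderiv]
  rfl

theorem DGam_add_smul {N v w : E3 × ℝ → E3} {x : E3} {t : ℝ}
    (hv : DifferentiableAt ℝ (fun y => v (y, t)) x) (hw : DifferentiableAt ℝ (fun y => w (y, t)) x)
    (s : ℝ) : DGam N (fun p => v p + s • w p) x t = DGam N v x t + s • DGam N w x t := by
  have : Dmat (fun p => v p + s • w p) x t = Dmat v x t + s • Dmat w x t := by
    ext i j
    simp only [Dmat, Matrix.of_apply, Matrix.add_apply, Matrix.smul_apply, smul_eq_mul,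
      pdx_add_smul hv hw s]
    ring
  simp only [DGam, this, Matrix.mul_add, Matrix.add_mul, Matrix.mul_smul, Matrix.smul_mul]

theorem sdiv_add_smul {N v w : E3 × ℝ → E3} {x : E3} {t : ℝ}
    (hv : DifferentiableAt ℝ (fun y => v (y, t)) x) (hw : DifferentiableAt ℝ (fun y => w (y, t)) x)
    (s : ℝ) : _root_.sdiv N (fun p => v p + s • w p) x t =
      _root_.sdiv N v x t + s * _root_.sdiv N w x t := by
  simp only [_root_.sdiv, tder, pdx_add_smul hv hw s, Finset.mul_sum, ← Finset.sum_add_distrib]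
  exact Finset.sum_congr rfl fun j _ => Finset.sum_congr rfl fun i _ => by ring

/-- The Frobenius inner product of matrices. -/
def frobInner (A B : Matrix (Fin 3) (Fin 3) ℝ) : ℝ := ∑ i, ∑ j, A i j * B i j

theorem frobInner_eq_trace (A B : Matrix (Fin 3) (Fin 3) ℝ) :
    frobInner A B = (A.transpose * B).trace := by
  simp only [frobInner, Matrix.trace, Matrix.diag, Matrix.mul_apply, Matrix.transpose_apply]
  exact Finset.sum_comm

theorem hasDerivAt_frob2_add_smul (A B : Matrix (Fin 3) (Fin 3) ℝ) (s : ℝ) :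
    HasDerivAt (fun r => frob2 (A + r • B)) (2 * frobInner (A + s • B) B) s := by
  simp only [frob2, frobInner, Finset.mul_sum]
  refine HasDerivAt.fun_sum fun i _ => HasDerivAt.fun_sum fun j _ => ?_
  refine (((hasDerivAt_id s).mul_const (B i j)).const_add (A i j)).pow 2 |>.congr_deriv ?_
  simp [mul_assoc]

theorem hasDerivAt_dissipation_density {e₁ e₂ : ℝ → ℝ} (he₁ : Differentiable ℝ e₁)
    (he₂ : Differentiable ℝ e₂) (A B : Matrix (Fin 3) (Fin 3) ℝ) (a b s : ℝ) :
    HasDerivAt (fun r => (1 / 2) * (e₁ (frob2 (A + r • B)) + e₂ ((a + r * b) ^ 2)))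
      (deriv e₁ (frob2 (A + s • B)) * frobInner (A + s • B) B
        + deriv e₂ ((a + s * b) ^ 2) * (a + s * b) * b) s := by
  have h₁ := (he₁ _).hasDerivAt.comp s (hasDerivAt_frob2_add_smul A B s)
  have h₂ := (he₂ _).hasDerivAt.comp s
    ((((hasDerivAt_id s).mul_const b).const_add a).pow 2)
  refine ((h₁.add h₂).const_mul (1 / 2)).congr_deriv ?_
  simp
  ring

theorem Pmat_transpose (N : E3 × ℝ → E3) (x : E3) (t : ℝ) :
    (Pmat N x t).transpose = Pmat N x t := by
  ext i j
  simp [Pmat, eq_comm, mul_comm]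

theorem Pmat_mul_self {N : E3 × ℝ → E3} {x : E3} {t : ℝ} (hn : dot3 (N (x, t)) (N (x, t)) = 1) :
    Pmat N x t * Pmat N x t = Pmat N x t := by
  rw [dot3_def] at hn
  ext i j
  have : (Pmat N x t * Pmat N x t) i j = Pmat N x t i j
      + N (x, t) i * N (x, t) j * ((N (x, t) 0 * N (x, t) 0 + N (x, t) 1 * N (x, t) 1
        + N (x, t) 2 * N (x, t) 2) - 1) := by
    simp only [Pmat, Matrix.mul_apply, Matrix.of_apply, Fin.sum_univ_three]
    fin_cases i <;> fin_cases j <;> simp <;> ring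
  rw [this, hn]
  ring

theorem Pmat_mulVec_normal {N : E3 × ℝ → E3} {x : E3} {t : ℝ}
    (hn : dot3 (N (x, t)) (N (x, t)) = 1) : (Pmat N x t).mulVec (N (x, t)).ofLp = 0 := by
  rw [dot3_def] at hn
  ext i
  have : (Pmat N x t).mulVec (N (x, t)).ofLp i = N (x, t) i * (1 -
      (N (x, t) 0 * N (x, t) 0 + N (x, t) 1 * N (x, t) 1 + N (x, t) 2 * N (x, t) 2)) := by
    simp only [Pmat, Matrix.mulVec, dotProduct, Matrix.of_apply, Fin.sum_univ_three]
    fin_cases i <;> simp <;> ring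
  rw [this, hn]
  simp

theorem Dmat_transpose (w : E3 × ℝ → E3) (x : E3) (t : ℝ) :
    (Dmat w x t).transpose = Dmat w x t := by
  ext i j
  simp [Dmat, add_comm]

theorem DGam_transpose (N w : E3 × ℝ → E3) (x : E3) (t : ℝ) :
    (DGam N w x t).transpose = DGam N w x t := by
  simp [DGam, Matrix.transpose_mul, Pmat_transpose, Dmat_transpose, Matrix.mul_assoc]

theorem sum_mul_tder_eq_frobInner (N w : E3 × ℝ → E3) (M : Matrix (Fin 3) (Fin 3) ℝ) (x : E3)
    (t : ℝ) : ∑ j, ∑ i, M i j * tder N j (fun p => w p i) x t =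
      frobInner M ((Matrix.of fun i k => pdx k (fun p => w p i) x t) * Pmat N x t) := by
  rw [frobInner, Finset.sum_comm]
  simp only [tder, Matrix.mul_apply, Pmat, Matrix.of_apply, mul_comm]

theorem sum_DGam_mul_tder {N v w : E3 × ℝ → E3} {x : E3} {t : ℝ}
    (hn : dot3 (N (x, t)) (N (x, t)) = 1) :
    ∑ j, ∑ i, DGam N v x t i j * tder N j (fun p => w p i) x t =
      frobInner (DGam N v x t) (DGam N w x t) := by
  set G : Matrix (Fin 3) (Fin 3) ℝ := Matrix.of fun i k => pdx k (fun p => w p i) x t with hG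
  have hD : Dmat w x t = (1 / 2 : ℝ) • (G + G.transpose) := by
    ext i j
    simp [Dmat, hG]
    ring
  have hP := Pmat_mul_self hn
  have hPA : Pmat N x t * DGam N v x t = DGam N v x t := by
    simp only [DGam, ← Matrix.mul_assoc, hP]
  have hAP : DGam N v x t * Pmat N x t = DGam N v x t := by
    simp only [DGam, Matrix.mul_assoc, hP]
  have hL : ∀ Y, (DGam N v x t * (Y * Pmat N x t)).trace = (DGam N v x t * Y).trace := fun Y => by
    rw [← Matrix.mul_assoc, Matrix.trace_mul_comm, ← Matrix.mul_assoc, hPA]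
  have hT : (DGam N v x t * G.transpose).trace = (DGam N v x t * G).trace := by
    rw [← Matrix.trace_transpose, Matrix.transpose_mul, Matrix.transpose_transpose, DGam_transpose,
      Matrix.trace_mul_comm]
  rw [sum_mul_tder_eq_frobInner, frobInner_eq_trace, frobInner_eq_trace, DGam_transpose, hL]
  conv_rhs => rw [DGam.eq_def N w, hL, ← Matrix.mul_assoc, hAP, hD]
  rw [Matrix.mul_smul, Matrix.mul_add, Matrix.trace_smul, Matrix.trace_add, hT, smul_eq_mul]
  ring

theorem sum_Pmat_mul_tder {N w : E3 × ℝ → E3} {x : E3} {t : ℝ}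
    (hn : dot3 (N (x, t)) (N (x, t)) = 1) :
    ∑ j, ∑ i, Pmat N x t i j * tder N j (fun p => w p i) x t = _root_.sdiv N w x t := by
  rw [sum_mul_tder_eq_frobInner, frobInner_eq_trace, Pmat_transpose, Matrix.trace_mul_comm,
    Matrix.mul_assoc, Pmat_mul_self hn]
  simp only [Matrix.trace, Matrix.diag, Matrix.mul_apply, Pmat, Matrix.of_apply, _root_.sdiv, tder,
    mul_comm]

theorem tder_mul {N : E3 × ℝ → E3} {g h : E3 × ℝ → ℝ} {x : E3} {t : ℝ}
    (hg : DifferentiableAt ℝ (fun y => g (y, t)) x) (hh : DifferentiableAt ℝ (fun y => h (y, t)) x)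
    (j : Fin 3) : tder N j (fun p => g p * h p) x t =
      tder N j g x t * h (x, t) + g (x, t) * tder N j h x t := by
  simp only [tder, pdx, fderiv_fun_mul hg hh, Finset.sum_mul, Finset.mul_sum,
    ← Finset.sum_add_distrib]
  refine Finset.sum_congr rfl fun i _ => ?_
  simp
  ring

theorem tder_sum {N : E3 × ℝ → E3} {g : Fin 3 → E3 × ℝ → ℝ} {x : E3} {t : ℝ}
    (hg : ∀ k, DifferentiableAt ℝ (fun y => g k (y, t)) x) (j : Fin 3) :
    tder N j (fun p => ∑ k, g k p) x t = ∑ k, tder N j (g k) x t := by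
  simp only [tder, pdx, fderiv_fun_sum fun k _ => hg k]
  rw [Finset.sum_comm]
  simp [Finset.mul_sum]

/-- The product rule `div_Γ (Mᵀ w) = (div_Γ M) · w + M : ∇_Γ w`. -/
theorem sdiv_transpose_mulVec {N w : E3 × ℝ → E3} {M : E3 × ℝ → Matrix (Fin 3) (Fin 3) ℝ} {x : E3}
    {t : ℝ} (hM : ∀ i j, DifferentiableAt ℝ (fun y => M (y, t) i j) x)
    (hw : ∀ i, DifferentiableAt ℝ (fun y => w (y, t) i) x) :
    _root_.sdiv N (fun p => mulVec3 (M p).transpose (w p)) x t =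
      dot3 (sdivM N M x t) (w (x, t)) +
        ∑ j, ∑ i, M (x, t) i j * tder N j (fun p => w p i) x t := by
  have : ∀ j, tder N j (fun p => mulVec3 (M p).transpose (w p) j) x t =
      ∑ i, (tder N j (fun p => M p i j) x t * w (x, t) i
        + M (x, t) i j * tder N j (fun p => w p i) x t) := fun j => by
    simp only [← tder_mul (N := N) (g := fun p => M p _ j) (h := fun p => w p _) (hM _ j) (hw _)]
    exact tder_sum (g := fun i p => M p i j * w p i) (fun i => (hM i j).mul (hw i)) j
  simp only [_root_.sdiv, this, Finset.sum_add_distrib]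
  congr 1
  rw [Finset.sum_comm]
  simp [dot3, sdivM, Finset.sum_mul]

theorem continuous_frob2 : Continuous frob2 := by
  unfold frob2
  fun_prop

theorem continuous_frobInner :
    Continuous fun p : Matrix (Fin 3) (Fin 3) ℝ × Matrix (Fin 3) (Fin 3) ℝ =>
      frobInner p.1 p.2 := by
  unfold frobInner
  fun_prop

theorem Gdet_eq_norm_cross3_sq (xh : E2 × ℝ → E3) (X : E2) (t : ℝ) :
    Gdet xh X t = ‖cross3 (gVec xh 0 X t) (gVec xh 1 X t)‖ ^ 2 := by
  rw [← dot3_self]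
  simp only [Gdet, gMet, dot3_def, cross3_apply_zero, cross3_apply_one, cross3_apply_two]
  ring

/-- The first variation of the dissipation energy, before integrating by parts. -/
theorem hasDerivAt_setIntegral_dissipation {f : E2 → E3} (hf : ContDiff ℝ 1 f) {U : Set E2}
    (hU : Bornology.IsBounded U) (hfU : MeasurableSet (f '' U)) {N v w : E3 × ℝ → E3} {t : ℝ}
    (hN : ContDiff ℝ 0 fun x => N (x, t)) (hv : ContDiff ℝ 1 fun x => v (x, t))
    (hw : ContDiff ℝ 1 fun x => w (x, t)) {e₁ e₂ : ℝ → ℝ} (he₁ : ContDiff ℝ 1 e₁)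
    (he₂ : ContDiff ℝ 1 e₂) :
    HasDerivAt
      (fun s : ℝ => ∫ x in f '' U,
        (1 / 2) * (e₁ (frob2 (DGam N (fun p => v p + s • w p) x t))
          + e₂ ((_root_.sdiv N (fun p => v p + s • w p) x t) ^ 2)) ∂(μH[2] : Measure E3))
      (∫ x in f '' U,
        (deriv e₁ (frob2 (DGam N v x t)) * frobInner (DGam N v x t) (DGam N w x t)
          + deriv e₂ ((_root_.sdiv N v x t) ^ 2) * _root_.sdiv N v x t * _root_.sdiv N w x t)
        ∂(μH[2] : Measure E3)) 0 := by
  have hC : IsCompact (f '' closure U) := hU.isCompact_closure.image hf.continuous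
  have : IsFiniteMeasure ((μH[2] : Measure E3).restrict (f '' U)) :=
    ⟨by simpa using hausdorffMeasure_two_image_lt_top hf hU⟩
  have hdiff : ∀ {u : E3 × ℝ → E3}, (ContDiff ℝ 1 fun x => u (x, t)) →
      Differentiable ℝ fun x => u (x, t) := fun hu => hu.differentiable one_ne_zero
  have hA : ∀ {u : E3 × ℝ → E3}, (ContDiff ℝ 1 fun x => u (x, t)) →
      Continuous fun x => DGam N u x t := fun hu => continuous_matrix fun i j =>
    (contDiff_DGam hN (by simpa using hu) i j).continuous
  have ha : ∀ {u : E3 × ℝ → E3}, (ContDiff ℝ 1 fun x => u (x, t)) →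
      Continuous fun x => _root_.sdiv N u x t := fun hu =>
    (contDiff_sdiv hN (by simpa using hu)).continuous
  have hAv := hA hv
  have hAw := hA hw
  have hav := ha hv
  have haw := ha hw
  have hc₁ := he₁.continuous
  have hc₂ := he₂.continuous
  have hd₁ := he₁.continuous_deriv_one
  have hd₂ := he₂.continuous_deriv_one
  have hfr := continuous_frob2
  simp only [fun s x => DGam_add_smul (N := N) (hdiff hv x) (hdiff hw x) s,
    fun s x => sdiv_add_smul (N := N) (hdiff hv x) (hdiff hw x) s]
  have hAs : Continuous fun p : ℝ × E3 => DGam N v p.2 t + p.1 • DGam N w p.2 t := by fun_prop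
  have key := hasDerivAt_integral_of_continuous_of_compact hC
    (ae_restrict_of_forall_mem (μ := (μH[2] : Measure E3)) hfU
      fun x hx => image_mono subset_closure hx)
    (F := fun s x => (1 / 2) * (e₁ (frob2 (DGam N v x t + s • DGam N w x t))
      + e₂ ((_root_.sdiv N v x t + s * _root_.sdiv N w x t) ^ 2)))
    (by fun_prop) (?_ : Continuous _)
    (fun s x => hasDerivAt_dissipation_density (he₁.differentiable one_ne_zero)
      (he₂.differentiable one_ne_zero) _ _ _ _ s) 0
  · simpa using key
  · exact ((hd₁.comp (hfr.comp hAs)).mul (continuous_frobInner.comp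
      (hAs.prodMk (hAw.comp continuous_snd)))).add (by fun_prop)

theorem integrableOn_image_of_continuous {f : E2 → E3} (hf : ContDiff ℝ 1 f) {U : Set E2}
    (hU : Bornology.IsBounded U) (hfU : MeasurableSet (f '' U)) {h : E3 → ℝ} (hh : Continuous h) :
    IntegrableOn h (f '' U) (μH[2] : Measure E3) := by
  obtain ⟨b, hb⟩ := (hU.isCompact_closure.image hf.continuous).exists_bound_of_continuousOn
    hh.continuousOn
  exact IntegrableOn.of_bound (hausdorffMeasure_two_image_lt_top hf hU) hh.aestronglyMeasurable b
    (ae_restrict_of_forall_mem hfU fun x hx => hb x (image_mono subset_closure hx))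

end DissipationEnergy

/-- variation of the dissipation energy `E_D` with respect to the velocity. -/
theorem variation_of_dissipation_energy
    (T : ℝ) (hT : 0 < T)
    (U : Set E2) (hUopen : IsOpen U) (hUne : U.Nonempty) (hUbd : Bornology.IsBounded U)
    (xh : E2 × ℝ → E3) (hxh : ContDiff ℝ 2 xh)
    (lam : ℝ) (hlam : 0 < lam)
    (hG : ∀ X ∈ U, ∀ t ∈ Set.Ico (0 : ℝ) T, lam ≤ Gdet xh X t)
    (hinj : ∀ t ∈ Set.Ico (0 : ℝ) T, Set.InjOn (fun X => xh (X, t)) U)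
    (Γ : ℝ → Set E3) (hΓ : ∀ t, Γ t = (fun X => xh (X, t)) '' U)
    (N : E3 × ℝ → E3) (hN : ContDiff ℝ 1 N)
    (hNs : ∀ X ∈ U, ∀ t ∈ Set.Ico (0 : ℝ) T, N (xh (X, t), t) = nHat xh X t)
    (v : E3 × ℝ → E3) (hv : ContDiff ℝ 2 v)
    (hflow : ∀ X ∈ U, ∀ t ∈ Set.Ico (0 : ℝ) T,
      deriv (fun s => xh (X, s)) t = v (xh (X, t), t))
    (e₁ e₂ : ℝ → ℝ) (he₁ : ContDiff ℝ 2 e₁) (he₂ : ContDiff ℝ 2 e₂)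
    (t : ℝ) (ht : t ∈ Set.Ioo (0 : ℝ) T)
    (φ : E3 → E3) (hφ : ContDiff ℝ 1 φ)
    (K : Set E2) (hK : IsCompact K) (hKU : K ⊆ U)
    (hφsupp : ∀ X ∈ U \ K, φ (xh (X, t)) = 0) :
    HasDerivAt
      (fun ε : ℝ =>
        -(∫ x in Γ t,
            (1 / 2) * (e₁ (frob2 (DGam N (fun p => v p + ε • φ p.1) x t))
              + e₂ ((sdiv N (fun p => v p + ε • φ p.1) x t) ^ 2)) ∂(μH[2] : Measure E3)))
      (∫ x in Γ t,
        dot3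
          (sdivM N
            (fun p => deriv e₁ (frob2 (DGam N v p.1 p.2)) • DGam N v p.1 p.2
              + (deriv e₂ ((sdiv N v p.1 p.2) ^ 2) * sdiv N v p.1 p.2) • Pmat N p.1 p.2)
            x t)
          (φ x) ∂(μH[2] : Measure E3)) 0 := by
  have htT : t ∈ Set.Ico (0 : ℝ) T := ⟨ht.1.le, ht.2⟩
  have hslice : ContDiff ℝ 2 fun x : E3 => (x, t) := contDiff_id.prodMk contDiff_const
  have hf : ContDiff ℝ 2 fun X => xh (X, t) := hxh.comp (contDiff_id.prodMk contDiff_const)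
  have hN' : ContDiff ℝ 1 fun x => N (x, t) := hN.comp (hslice.of_le one_le_two)
  have hv' : ContDiff ℝ 2 fun x => v (x, t) := hv.comp hslice
  have hf1 := hf.of_le one_le_two
  have hv1 := hv'.of_le one_le_two
  have hreg : ∀ X ∈ U, cross3 (gVec xh 0 X t) (gVec xh 1 X t) ≠ 0 := fun X hX h0 => by
    have := hG X hX t htT
    rw [Gdet_eq_norm_cross3_sq, h0, norm_zero] at this
    linarith
  have hcross : ∀ X ∈ U, cross3 (gVec xh 0 X t) (gVec xh 1 X t) =
      ‖cross3 (gVec xh 0 X t) (gVec xh 1 X t)‖ • N (xh (X, t), t) := fun X hX => by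
    rw [hNs X hX t htT, nHat, smul_inv_smul₀ (norm_ne_zero_iff.2 (hreg X hX))]
  have hunit : ∀ X ∈ U, dot3 (N (xh (X, t), t)) (N (xh (X, t), t)) = 1 := fun X hX => by
    rw [hNs X hX t htT, dot3_self, nHat, norm_smul, norm_inv, norm_norm,
      inv_mul_cancel₀ (norm_ne_zero_iff.2 (hreg X hX)), one_pow]
  have hfU : MeasurableSet ((fun X => xh (X, t)) '' U) :=
    hUopen.measurableSet.image_of_continuousOn_injOn hf.continuous.continuousOn (hinj t htT)
  rw [hΓ]
  refine (hasDerivAt_setIntegral_dissipation hf1 hUbd hfU (hN'.of_le zero_le_one) hv1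
    (w := fun p => φ p.1) hφ (he₁.of_le one_le_two) (he₂.of_le one_le_two)).neg.congr_deriv ?_
  set M : E3 × ℝ → Matrix (Fin 3) (Fin 3) ℝ := fun p =>
    deriv e₁ (frob2 (DGam N v p.1 p.2)) • DGam N v p.1 p.2
      + (deriv e₂ ((sdiv N v p.1 p.2) ^ 2) * sdiv N v p.1 p.2) • Pmat N p.1 p.2 with hM
  have hAv := contDiff_DGam hN' (show ContDiff ℝ (1 + 1) _ by simpa [one_add_one_eq_two] using hv')
  have hav := contDiff_sdiv hN' (show ContDiff ℝ (1 + 1) _ by simpa [one_add_one_eq_two] using hv')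
  have hde : ∀ {e : ℝ → ℝ}, ContDiff ℝ 2 e → ContDiff ℝ 1 (deriv e) := fun he =>
    ((contDiff_succ_iff_deriv (n := 1)).1 (by simpa [one_add_one_eq_two] using he)).2.2
  have hMC : ∀ i j, ContDiff ℝ 1 fun x => M (x, t) i j := fun i j =>
    (((hde he₁).comp (ContDiff.frob2 hAv)).mul (hAv i j)).add
      ((((hde he₂).comp (hav.pow 2)).mul hav).mul (contDiff_Pmat hN' i j))
  have hφi := contDiff_euclidean_apply hφ
  set W : E3 × ℝ → E3 := fun p => mulVec3 (M p).transpose (φ p.1) with hW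
  have hWC : ContDiff ℝ 1 fun x => W (x, t) := contDiff_euclidean.2 fun j => by
    change ContDiff ℝ 1 fun x => ∑ i, M (x, t) i j * φ x i
    exact ContDiff.sum fun i _ => (hMC i j).mul (hφi i)
  have hzero := setIntegral_sdiv_eq_zero hf hUopen (hinj t htT) hK hKU hreg hN' hWC hcross hunit
    (fun X hX => ?_) (fun X hX => by
      ext i
      simp [hW, mulVec3, Matrix.mulVec, dotProduct, hφsupp X hX])
  · have hprod : ∀ x, sdiv N W x t = dot3 (sdivM N M x t) (φ x) +
        ∑ j, ∑ i, M (x, t) i j * tder N j (fun p => φ p.1 i) x t := fun x =>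
      sdiv_transpose_mulVec (w := fun p => φ p.1)
        (fun i j => (hMC i j).differentiable one_ne_zero x)
        fun i => (hφi i).differentiable one_ne_zero x
    have hvar : ∀ x ∈ (fun X => xh (X, t)) '' U, sdiv N W x t =
        dot3 (sdivM N M x t) (φ x) +
          (deriv e₁ (frob2 (DGam N v x t)) * frobInner (DGam N v x t) (DGam N (fun p => φ p.1) x t)
          + deriv e₂ ((sdiv N v x t) ^ 2) * sdiv N v x t * sdiv N (fun p => φ p.1) x t) := by
      rintro _ ⟨X, hX, rfl⟩
      rw [hprod]
      congr 1
      rw [← sum_DGam_mul_tder (hunit X hX), ← sum_Pmat_mul_tder (w := fun p => φ p.1) (hunit X hX)]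
      simp only [hM, Matrix.add_apply, Matrix.smul_apply, smul_eq_mul, add_mul,
        Finset.sum_add_distrib, Finset.mul_sum, mul_assoc]
    rw [← zero_sub, ← hzero, ← integral_sub]
    · exact setIntegral_congr_fun hfU fun x hx => by
        rw [hvar x hx, add_sub_cancel_right]
    · exact integrableOn_image_of_continuous hf1 hUbd hfU
        (contDiff_sdiv (n := 0) (hN'.of_le zero_le_one) (by simpa using hWC)).continuous
    · have hB : Continuous fun x => DGam N (fun p => φ p.1) x t := continuous_matrix fun i j =>
        (contDiff_DGam (n := 0) (hN'.of_le zero_le_one) (by simpa using hφ) i j).continuous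
      have hA : Continuous fun x => DGam N v x t := continuous_matrix fun i j =>
        (hAv i j).continuous
      have hb : Continuous fun x => sdiv N (fun p => φ p.1) x t :=
        (contDiff_sdiv (n := 0) (hN'.of_le zero_le_one) (by simpa using hφ)).continuous
      exact integrableOn_image_of_continuous hf1 hUbd hfU
        ((((hde he₁).continuous.comp (continuous_frob2.comp hA)).mul
          (continuous_frobInner.comp (hA.prodMk hB))).add
        ((((hde he₂).continuous.comp (hav.continuous.pow 2)).mul hav.continuous).mul hb))
  · have hPN := Pmat_mulVec_normal (hunit X hX)
    have hMN : (M (xh (X, t), t)).mulVec (N (xh (X, t), t)).ofLp = 0 := by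
      simp only [hM, Matrix.add_mulVec, Matrix.smul_mulVec, DGam, ← Matrix.mulVec_mulVec, hPN,
        Matrix.mulVec_zero, smul_zero, add_zero]
    calc dot3 (W (xh (X, t), t)) (N (xh (X, t), t))
        = (M (xh (X, t), t)).transpose.mulVec (φ (xh (X, t))).ofLp ⬝ᵥ (N (xh (X, t), t)).ofLp := rfl
      _ = 0 := by
        rw [Matrix.mulVec_transpose, ← Matrix.dotProduct_mulVec, hMN, dotProduct_zero]
end
end

section
/- Let ρ : ℝ³ × ℝ → ℝ be C¹ and assume the continuity equation (D_t ρ + (div_Γ v) ρ)(x̂(X,t), t) = 0 holds for every X ∈ U and t ∈ [0,T). Then for every X ∈ U the function t ↦ ρ(x̂(X,t), t) √(G(X,t)) is constant on [0,T); in particular ρ(x̂(X,t), t) = ρ(x̂(X,0), 0) √(G(X,0)) / √(G(X,t)) for all t ∈ [0,T). -/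
noncomputable section
open MeasureTheory

/-- The square of the norm of `g₁ × g₂` is the Gram determinant. -/
lemma norm_cross3_sq (a b : E3) :
    ‖cross3 a b‖ ^ 2 = dot3 a a * dot3 b b - dot3 a b * dot3 b a := by
  simp [EuclideanSpace.norm_sq_eq, cross3, dot3, Fin.sum_univ_three]
  ring

lemma clm_apply_eq_sum (A : E3 →L[ℝ] E3) (w : E3) (j : Fin 3) :
    A w j = ∑ i, w i * A (EuclideanSpace.single i 1) j := by
  have h : w = ∑ i, w i • EuclideanSpace.single i (1 : ℝ) := by
    ext k
    fin_cases k <;> simp [Fin.sum_univ_three]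
  conv_lhs => rw [h]
  simp [map_sum]

/-- The derivative of the Gram determinant of two vectors moved by the linear field `A` is
`2 G` times the trace of `A` on the plane that they span. -/
lemma gram_deriv_eq (A : E3 →L[ℝ] E3) (a b : E3) (h : cross3 a b ≠ 0) :
    (dot3 (A a) a + dot3 a (A a)) * dot3 b b + dot3 a a * (dot3 (A b) b + dot3 b (A b))
      - ((dot3 (A a) b + dot3 a (A b)) * dot3 b a + dot3 a b * (dot3 (A b) a + dot3 b (A a)))
      = 2 * (dot3 a a * dot3 b b - dot3 a b * dot3 b a) *
        ∑ j, ∑ i, ((if i = j then (1 : ℝ) else 0)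
          - (‖cross3 a b‖⁻¹ • cross3 a b) i * (‖cross3 a b‖⁻¹ • cross3 a b) j)
            * A (EuclideanSpace.single i 1) j := by
  have hn : ‖cross3 a b‖ ≠ 0 := norm_ne_zero_iff.mpr h
  rw [← norm_cross3_sq]
  have key : 2 * ‖cross3 a b‖ ^ 2 *
        ∑ j, ∑ i, ((if i = j then (1 : ℝ) else 0)
          - (‖cross3 a b‖⁻¹ • cross3 a b) i * (‖cross3 a b‖⁻¹ • cross3 a b) j)
            * A (EuclideanSpace.single i 1) j
      = 2 * ∑ j, ∑ i, (‖cross3 a b‖ ^ 2 * (if i = j then (1 : ℝ) else 0)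
          - cross3 a b i * cross3 a b j) * A (EuclideanSpace.single i 1) j := by
    rw [mul_assoc, Finset.mul_sum]
    congr 1
    refine Finset.sum_congr rfl fun j _ => ?_
    rw [Finset.mul_sum]
    refine Finset.sum_congr rfl fun i _ => ?_
    simp only [PiLp.smul_apply, smul_eq_mul]
    field_simp
  rw [key, norm_cross3_sq]
  simp only [dot3, Fin.sum_univ_three, clm_apply_eq_sum A a, clm_apply_eq_sum A b]
  generalize A (EuclideanSpace.single 0 1) = p
  generalize A (EuclideanSpace.single 1 1) = q
  generalize A (EuclideanSpace.single 2 1) = r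
  simp [cross3]
  ring

lemma gVec_eq_fderiv {xh : E2 × ℝ → E3} (hxh : Differentiable ℝ xh) (α : Fin 2) (X : E2) (t : ℝ) :
    gVec xh α X t = fderiv ℝ xh (X, t) (EuclideanSpace.single α 1, 0) := by
  have h : HasFDerivAt (fun Y : E2 => xh (Y, t)) _ X :=
    (hxh (X, t)).hasFDerivAt.comp X (hasFDerivAt_prodMk_left X t)
  simp [gVec, h.fderiv]

lemma hasDerivAt_time {xh : E2 × ℝ → E3} (hxh : Differentiable ℝ xh) (X : E2) (t : ℝ) :
    HasDerivAt (fun s => xh (X, s)) (fderiv ℝ xh (X, t) (0, 1)) t := by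
  have h : HasFDerivAt (fun s => xh (X, s)) _ t :=
    (hxh (X, t)).hasFDerivAt.comp t (hasFDerivAt_prodMk_right X t)
  simpa using h.hasDerivAt

/-- Tangent vectors of a flow are transported by the spatial gradient of the velocity. -/
lemma hasDerivAt_gVec {xh : E2 × ℝ → E3} (hxh : ContDiff ℝ 2 xh) {v : E3 × ℝ → E3}
    (hv : Differentiable ℝ v) {X : E2} {t : ℝ}
    (hflow : ∀ᶠ Y in nhds X, deriv (fun s => xh (Y, s)) t = v (xh (Y, t), t)) (α : Fin 2) :
    HasDerivAt (fun s => gVec xh α X s)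
      (fderiv ℝ (fun y => v (y, t)) (xh (X, t)) (gVec xh α X t)) t := by
  have hd : Differentiable ℝ xh := hxh.differentiable (by norm_num)
  have hd2 : Differentiable ℝ (fderiv ℝ xh) :=
    (hxh.fderiv_right (m := 1) (by norm_num)).differentiable (by norm_num)
  have hsymm : IsSymmSndFDerivAt ℝ xh (X, t) :=
    hxh.contDiffAt.isSymmSndFDerivAt (by simp)
  have hX : HasFDerivAt (fun Y : E2 => xh (Y, t)) (fderiv ℝ (fun Y : E2 => xh (Y, t)) X) X :=
    ((hd (X, t)).comp X (hasFDerivAt_prodMk_left X t).differentiableAt).hasFDerivAt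
  have hvx : HasFDerivAt (fun y => v (y, t)) (fderiv ℝ (fun y => v (y, t)) (xh (X, t)))
      (xh (X, t)) :=
    ((hv (xh (X, t), t)).comp (xh (X, t))
      (hasFDerivAt_prodMk_left (xh (X, t)) t).differentiableAt).hasFDerivAt
  have hmixed : HasFDerivAt (fun Y : E2 => fderiv ℝ xh (Y, t) (0, 1)) _ X :=
    ((hd2 (X, t)).hasFDerivAt.comp X (hasFDerivAt_prodMk_left X t)).clm_apply
      (hasFDerivAt_const ((0 : E2), (1 : ℝ)) X)
  have hvel : HasFDerivAt (fun Y : E2 => fderiv ℝ xh (Y, t) (0, 1)) _ X :=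
    (hvx.comp X hX).congr_of_eventuallyEq
      (hflow.mono fun Y hY => by exact (hasDerivAt_time hd Y t).deriv.symm.trans hY)
  have heq := congrArg (fun L => L (EuclideanSpace.single α 1)) (hmixed.unique hvel)
  have htime : HasDerivAt (fun s => fderiv ℝ xh (X, s) (EuclideanSpace.single α 1, 0)) _ t :=
    (((hd2 (X, t)).hasFDerivAt.comp t (hasFDerivAt_prodMk_right X t)).clm_apply
      (hasFDerivAt_const (EuclideanSpace.single α (1 : ℝ), (0 : ℝ)) t)).hasDerivAt
  simp only [gVec_eq_fderiv hd α X]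
  convert htime using 1
  rw [← gVec_eq_fderiv hd α X, gVec]
  simp at heq ⊢
  rw [← heq, hsymm.eq]

lemma HasDerivAt.dot3 {f g : ℝ → E3} {f' g' : E3} {t : ℝ} (hf : HasDerivAt f f' t)
    (hg : HasDerivAt g g' t) :
    HasDerivAt (fun s => dot3 (f s) (g s)) (dot3 f' (g t) + dot3 (f t) g') t := by
  have hfi (i : Fin 3) : HasDerivAt (fun s => f s i) (f' i) t :=
    (EuclideanSpace.proj (𝕜 := ℝ) i).hasFDerivAt.comp_hasDerivAt t hf
  have hgi (i : Fin 3) : HasDerivAt (fun s => g s i) (g' i) t :=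
    (EuclideanSpace.proj (𝕜 := ℝ) i).hasFDerivAt.comp_hasDerivAt t hg
  have h := HasDerivAt.fun_sum (u := Finset.univ) fun i _ => (hfi i).mul (hgi i)
  simpa [_root_.dot3, Finset.sum_add_distrib] using h

lemma pdx_apply {v : E3 × ℝ → E3} (hv : Differentiable ℝ v) (i j : Fin 3) (x : E3) (t : ℝ) :
    pdx i (fun p => v p j) x t
      = fderiv ℝ (fun y => v (y, t)) x (EuclideanSpace.single i 1) j := by
  have hvx : DifferentiableAt ℝ (fun y => v (y, t)) x :=
    (hv (x, t)).comp x (hasFDerivAt_prodMk_left x t).differentiableAt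
  have h : HasFDerivAt (fun y => v (y, t) j) _ x :=
    (EuclideanSpace.proj (𝕜 := ℝ) j).hasFDerivAt.comp x hvx.hasFDerivAt
  simp [pdx, h.fderiv]

/-- The Gram determinant of a flow satisfies `∂_t G = 2 G div_Γ v`. -/
lemma hasDerivAt_Gdet {xh : E2 × ℝ → E3} (hxh : ContDiff ℝ 2 xh) {N v : E3 × ℝ → E3}
    (hv : Differentiable ℝ v) {X : E2} {t : ℝ}
    (hflow : ∀ᶠ Y in nhds X, deriv (fun s => xh (Y, s)) t = v (xh (Y, t), t))
    (hN : N (xh (X, t), t) = nHat xh X t) (hG : Gdet xh X t ≠ 0) :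
    HasDerivAt (fun s => Gdet xh X s) (2 * Gdet xh X t * sdiv N v (xh (X, t)) t) t := by
  have h0 := hasDerivAt_gVec hxh hv hflow 0
  have h1 := hasDerivAt_gVec hxh hv hflow 1
  have hc : cross3 (gVec xh 0 X t) (gVec xh 1 X t) ≠ 0 := by
    intro h
    apply hG
    rw [Gdet, gMet, gMet, gMet, gMet, ← norm_cross3_sq, h]
    simp
  have h := ((h0.dot3 h0).mul (h1.dot3 h1)).sub ((h0.dot3 h1).mul (h1.dot3 h0))
  rw [gram_deriv_eq _ _ _ hc] at h
  simp only [sdiv, tder, pdx_apply hv, hN]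
  exact h

/-- The chain rule along a trajectory of `v`: `d/dt f(x(t), t) = D_t f`. -/
lemma hasDerivAt_along_flow {f : E3 × ℝ → ℝ} (hf : Differentiable ℝ f) {v : E3 × ℝ → E3}
    {x : ℝ → E3} {t : ℝ} (hx : HasDerivAt x (v (x t, t)) t) :
    HasDerivAt (fun s => f (x s, s)) (Dt v f (x t) t) t := by
  have h : HasDerivAt (fun s => f (x s, s)) _ t :=
    (hf (x t, t)).hasFDerivAt.comp_hasDerivAt (f := fun s => (x s, s)) t
      (hx.prodMk (hasDerivAt_id t))
  have hs : HasFDerivAt (fun y => f (y, t)) _ (x t) :=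
    (hf (x t, t)).hasFDerivAt.comp (x t) (hasFDerivAt_prodMk_left (x t) t)
  have ht : HasFDerivAt (fun s => f (x t, s)) _ t :=
    (hf (x t, t)).hasFDerivAt.comp t (hasFDerivAt_prodMk_right (x t) t)
  convert h using 1
  simp only [Dt, pdt, pdx, ht.hasDerivAt.deriv, hs.fderiv]
  generalize v (x t, t) = w
  have hw : (w, (1 : ℝ))
      = (0, 1) + ∑ i, w i • (EuclideanSpace.single i (1 : ℝ), (0 : ℝ)) := by
    ext k
    · fin_cases k <;> simp [Fin.sum_univ_three]
    · simp [Fin.sum_univ_three]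
  rw [hw, map_add, map_sum]
  simp only [map_smul]
  simp

/-- along the flow the mass density satisfies `ρ √G = const`, i.e.
`ρ(x̂(X,t),t) = ρ(x̂(X,0),0) √(G(X,0)) / √(G(X,t))`. -/
theorem density_representation
    (T : ℝ) (hT : 0 < T)
    (U : Set E2) (hUopen : IsOpen U) (hUne : U.Nonempty) (hUbd : Bornology.IsBounded U)
    (xh : E2 × ℝ → E3) (hxh : ContDiff ℝ 2 xh)
    (lam : ℝ) (hlam : 0 < lam)
    (hG : ∀ X ∈ U, ∀ t ∈ Set.Ico (0 : ℝ) T, lam ≤ Gdet xh X t)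
    (N : E3 × ℝ → E3) (hN : ContDiff ℝ 1 N)
    (hNs : ∀ X ∈ U, ∀ t ∈ Set.Ico (0 : ℝ) T, N (xh (X, t), t) = nHat xh X t)
    (v : E3 × ℝ → E3) (hv : ContDiff ℝ 2 v)
    (hflow : ∀ X ∈ U, ∀ t ∈ Set.Ico (0 : ℝ) T,
      deriv (fun s => xh (X, s)) t = v (xh (X, t), t))
    (ρ : E3 × ℝ → ℝ) (hρ : ContDiff ℝ 1 ρ)
    (hcont : ∀ X ∈ U, ∀ t ∈ Set.Ico (0 : ℝ) T,
      Dt v ρ (xh (X, t)) t + sdiv N v (xh (X, t)) t * ρ (xh (X, t), t) = 0) :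
    ∀ X ∈ U, ∀ t ∈ Set.Ico (0 : ℝ) T,
      ρ (xh (X, t), t) * Real.sqrt (Gdet xh X t)
          = ρ (xh (X, 0), 0) * Real.sqrt (Gdet xh X 0) ∧
      ρ (xh (X, t), t)
        = ρ (xh (X, 0), 0) * Real.sqrt (Gdet xh X 0) / Real.sqrt (Gdet xh X t) := by
  intro X hX t ht
  have hxd : Differentiable ℝ xh := hxh.differentiable (by norm_num)
  have hvd : Differentiable ℝ v := hv.differentiable (by norm_num)
  have hpos : ∀ s ∈ Set.Ico (0 : ℝ) T, 0 < Gdet xh X s := fun s hs => hlam.trans_le (hG X hX s hs)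
  have hder : ∀ s ∈ Set.Ico (0 : ℝ) T,
      HasDerivAt (fun s => ρ (xh (X, s), s) * √(Gdet xh X s)) 0 s := by
    intro s hs
    have hGs := hasDerivAt_Gdet hxh hvd
      (Filter.eventually_of_mem (hUopen.mem_nhds hX) fun Y hY => hflow Y hY s hs)
      (hNs X hX s hs) (hpos s hs).ne'
    have htraj : HasDerivAt (fun s => xh (X, s)) (v (xh (X, s), s)) s := by
      rw [← hflow X hX s hs]
      exact (hasDerivAt_time hxd X s).differentiableAt.hasDerivAt
    have hρs := hasDerivAt_along_flow (hρ.differentiable (by norm_num)) htraj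
    refine (hρs.mul (hGs.sqrt (hpos s hs).ne')).congr_deriv ?_
    rw [eq_neg_of_add_eq_zero_left (hcont X hX s hs)]
    have hsq := Real.sq_sqrt (hpos s hs).le
    have hne := (Real.sqrt_pos.mpr (hpos s hs)).ne'
    field_simp
    rw [hsq]
    ring
  have hsub : ∀ s ∈ Set.Icc 0 t, s ∈ Set.Ico (0 : ℝ) T := fun s hs => ⟨hs.1, hs.2.trans_lt ht.2⟩
  have hconst := constant_of_has_deriv_right_zero
    (fun s hs => (hder s (hsub s hs)).continuousAt.continuousWithinAt)
    (fun s hs => (hder s (hsub s (Set.Ico_subset_Icc_self hs))).hasDerivWithinAt)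
    t (Set.right_mem_Icc.mpr ht.1)
  exact ⟨hconst, (eq_div_iff (Real.sqrt_pos.mpr (hpos t ht)).ne').mpr hconst⟩
end
end
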